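/- Let Z be a self-adjoint element of a von Neumann algebra with normal faithful tracial state τ, with compactly supported distribution. Then for |z| small enough: M(z) − 1 = M(z) C^{(2)}(z) + R_1(Z) z M(z), and equivalently 1/M(z) = 1 − C^{(2)}(z) − R_1(Z) z; moreover C^{(2)}(z) = M(z) C^{(3)}(z) + R_2(Z) z² M(z). -/

import Mathlib

/-- A partition of `{0,…,n-1}` is non-crossing if no two distinct blocks cross. -/
def IsNonCrossing {n : ℕ} (ν : Finpartition (Finset.univ : Finset (Fin n))) : Prop :=
  ∀ B ∈ ν.parts, ∀ C ∈ ν.parts, B ≠ C →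
    ∀ i ∈ B, ∀ k ∈ B, ∀ j ∈ C, ∀ l ∈ C, i < j → j < k → k < l → False

/-- The first `k` elements of `{0,…,n-1}` all lie in one block of the partition
(this is the defining condition of the class `NC^k`). -/
def FirstTogether {n : ℕ} (k : ℕ)
    (ν : Finpartition (Finset.univ : Finset (Fin n))) : Prop :=
  ∃ B ∈ ν.parts, ∀ i : Fin n, (i : ℕ) < k → i ∈ B

/-- `R_ν(X₁,…,Xₙ) = ∏_{B ∈ ν} R_{|B|}(X_i : i ∈ B)`, the product of cumulant
functionals over the blocks of a partition (arguments in increasing order). -/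
noncomputable def partCum {A : Type*} [Ring A] (R : (k : ℕ) → (Fin k → A) → ℂ)
    {n : ℕ} (X : Fin n → A)
    (ν : Finpartition (Finset.univ : Finset (Fin n))) : ℂ :=
  ∏ B ∈ ν.parts, R B.card (fun i => X (B.orderIsoOfFin rfl i).1)

/-- `R` is the family of free cumulant functionals of `τ` : the moment–cumulant
formula `τ(X₁⋯Xₙ) = Σ_{ν ∈ NC(n)} R_ν(X₁,…,Xₙ)` holds. -/
def MomentCumulant {A : Type*} [Ring A] [Algebra ℂ A] (τ : A →ₗ[ℂ] ℂ)
    (R : (k : ℕ) → (Fin k → A) → ℂ) : Prop :=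
  ∀ n : ℕ, 0 < n → ∀ X : Fin n → A,
    τ (List.ofFn X).prod =
      ∑ᶠ ν : {ν : Finpartition (Finset.univ : Finset (Fin n)) // IsNonCrossing ν},
        partCum R X ν.1

/-- `c^k` sums : `ncSum R Z k m = Σ_{ν ∈ NC^k(m)} R_ν(Z,…,Z)`. -/
noncomputable def ncSum {A : Type*} [Ring A] (R : (k : ℕ) → (Fin k → A) → ℂ)
    (Z : A) (k m : ℕ) : ℂ :=
  ∑ᶠ ν : {ν : Finpartition (Finset.univ : Finset (Fin m)) //
      IsNonCrossing ν ∧ FirstTogether k ν},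
    partCum R (fun _ => Z) ν.1

/-- `X` and `Y` are freely independent: all their mixed free cumulants vanish. -/
def FreeIndep {A : Type*} [Ring A] (R : (k : ℕ) → (Fin k → A) → ℂ)
    (X Y : A) : Prop :=
  ∀ k : ℕ, ∀ W : Fin k → A,
    (∀ i, W i = X ∨ W i = Y) → (∃ i j, W i ≠ W j) → R k W = 0

/-- A (von Neumann algebra style) normal faithful tracial state on a complex
star algebra with a (weak-*) topology. -/
structure TracialState (A : Type*) [Ring A] [Algebra ℂ A] [StarRing A]
    [TopologicalSpace A] where
  τ : A →ₗ[ℂ] ℂ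
  map_one : τ 1 = 1
  tracial : ∀ x y : A, τ (x * y) = τ (y * x)
  pos : ∀ x : A, 0 ≤ (τ (star x * x)).re ∧ (τ (star x * x)).im = 0
  faithful : ∀ x : A, τ (star x * x) = 0 → x = 0
  normal : ∀ z : A, Continuous fun y : A => τ (z * y)

/-- The (von Neumann) subalgebra generated by `V` and the identity: the closure
of the unital algebra generated by `V`. -/
def vnGen {A : Type*} [Ring A] [Algebra ℂ A] [TopologicalSpace A] (V : A) : Set A :=
  closure ((Algebra.adjoin ℂ ({V} : Set A) : Subalgebra ℂ A) : Set A)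

/-- `W` is the conditional expectation `τ(U | V)` of `U` onto the von Neumann
subalgebra generated by `V` and the identity: `W` belongs to that subalgebra and
`τ(U Y) = τ(W Y)` for every `Y` in it. -/
def IsCondExp {A : Type*} [Ring A] [Algebra ℂ A] [TopologicalSpace A]
    (τ : A →ₗ[ℂ] ℂ) (V U W : A) : Prop :=
  W ∈ vnGen V ∧ ∀ Y ∈ vnGen V, τ (U * Y) = τ (W * Y)

open Finset in
/-- `c` is (the set of blocks of) a non-crossing partition of `s` with `T` in one block. -/
def NCP (s T : Finset ℕ) (c : Finset (Finset ℕ)) : Prop :=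
  (∀ B ∈ c, B.Nonempty ∧ B ⊆ s) ∧ (∀ x ∈ s, ∃ B ∈ c, x ∈ B) ∧
  (∀ B ∈ c, ∀ C ∈ c, ∀ x, x ∈ B → x ∈ C → B = C) ∧
  (∀ B ∈ c, ∀ C ∈ c, ∀ i ∈ B, ∀ k ∈ B, ∀ j ∈ C, ∀ l ∈ C, i < j → j < k → k < l → B = C) ∧
  (∀ x ∈ T, ∀ y ∈ T, ∀ B ∈ c, x ∈ B → y ∈ B)

open Classical in
/-- Sum of block weights over non-crossing partitions of `s` with `T` in one block. -/
noncomputable def GG (r : ℕ → ℂ) (s T : Finset ℕ) : ℂ :=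
  ∑ c ∈ s.powerset.powerset.filter (NCP s T), ∏ B ∈ c, r B.card

theorem NCP.mem_pow {s T : Finset ℕ} {c : Finset (Finset ℕ)} (h : NCP s T c) :
    c ∈ s.powerset.powerset := by
  rw [Finset.mem_powerset]
  intro B hB
  exact Finset.mem_powerset.2 (h.1 B hB).2

theorem NCP.singleton_iff {s : Finset ℕ} {a : ℕ} {c : Finset (Finset ℕ)} :
    NCP s {a} c ↔ NCP s ∅ c := by
  unfold NCP
  simp +contextual

theorem GG_singleton (r : ℕ → ℂ) (s : Finset ℕ) (a : ℕ) : GG r s {a} = GG r s ∅ := by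
  classical
  unfold GG
  congr 1
  ext c
  simp [NCP.singleton_iff]

theorem GG_empty (r : ℕ → ℂ) : GG r ∅ ∅ = 1 := by
  classical
  unfold GG
  have : ((∅ : Finset ℕ).powerset.powerset.filter (NCP ∅ ∅)) = {∅} := by
    ext c
    simp only [Finset.mem_filter, Finset.mem_singleton]
    constructor
    · rintro ⟨-, h⟩
      rw [Finset.eq_empty_iff_forall_notMem]
      intro B hB
      obtain ⟨h1, h2⟩ := h.1 B hB
      obtain ⟨x, hx⟩ := h1
      simpa using h2 hx
    · rintro rfl
      simp [NCP]
  rw [this]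
  simp

theorem GG_self (r : ℕ → ℂ) (T : Finset ℕ) (hT : T.Nonempty) : GG r T T = r T.card := by
  classical
  unfold GG
  have : (T.powerset.powerset.filter (NCP T T)) = {{T}} := by
    ext c
    simp only [Finset.mem_filter, Finset.mem_singleton]
    constructor
    · rintro ⟨-, h⟩
      have key : ∀ B ∈ c, B = T := by
        intro B hB
        obtain ⟨h1, h2⟩ := h.1 B hB
        obtain ⟨x, hx⟩ := h1
        exact Finset.Subset.antisymm h2 (fun y hy => h.2.2.2.2 x (h2 hx) y hy B hB hx)
      obtain ⟨x, hx⟩ := hT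
      obtain ⟨B, hB, hxB⟩ := h.2.1 x hx
      ext C
      simp only [Finset.mem_singleton]
      constructor
      · exact key C
      · rintro rfl
        rw [← key B hB]; exact hB
    · rintro rfl
      simp +contextual [NCP, hT]
  rw [this]
  simp

/-- splitting lemma -/
theorem GG_split (r : ℕ → ℂ) (s I J T : Finset ℕ) (hs : I ∪ J = s) (hIJ : Disjoint I J)
    (hT : T ⊆ J)
    (hconv : ∀ i ∈ I, ∀ k ∈ I, ∀ j ∈ J, i < j → j < k → False)
    [DecidablePred fun c => NCP s T c ∧ ∀ B ∈ c, B ⊆ I ∨ B ⊆ J] :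
    ∑ c ∈ s.powerset.powerset.filter (fun c => NCP s T c ∧ ∀ B ∈ c, B ⊆ I ∨ B ⊆ J),
      ∏ B ∈ c, r B.card = GG r I ∅ * GG r J T := by
  classical
  unfold GG
  rw [Finset.sum_mul_sum, ← Finset.sum_product']
  have hdis : ∀ x, x ∈ I → x ∈ J → False := fun x h1 h2 => Finset.disjoint_left.1 hIJ h1 h2
  symm
  refine Finset.sum_bij' (fun p _ => p.1 ∪ p.2)
    (fun c _ => (c.filter (fun B => B ⊆ I), c.filter (fun B => B ⊆ J))) ?_ ?_ ?_ ?_ ?_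
  · rintro ⟨a, b⟩ hab
    simp only [Finset.mem_product, Finset.mem_filter] at hab
    obtain ⟨⟨-, ha⟩, ⟨-, hb⟩⟩ := hab
    obtain ⟨a1, a2, a3, a4, a5⟩ := ha
    obtain ⟨b1, b2, b3, b4, b5⟩ := hb
    have hN : NCP s T (a ∪ b) := by
      refine ⟨?_, ?_, ?_, ?_, ?_⟩
      · intro B hB
        rcases Finset.mem_union.1 hB with h | h
        · exact ⟨(a1 B h).1, (a1 B h).2.trans (hs ▸ Finset.subset_union_left)⟩
        · exact ⟨(b1 B h).1, (b1 B h).2.trans (hs ▸ Finset.subset_union_right)⟩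
      · intro x hx
        rw [← hs] at hx
        rcases Finset.mem_union.1 hx with h | h
        · obtain ⟨B, hB, hxB⟩ := a2 x h
          exact ⟨B, Finset.mem_union_left _ hB, hxB⟩
        · obtain ⟨B, hB, hxB⟩ := b2 x h
          exact ⟨B, Finset.mem_union_right _ hB, hxB⟩
      · intro B hB C hC x hxB hxC
        rcases Finset.mem_union.1 hB with h | h <;> rcases Finset.mem_union.1 hC with h' | h'
        · exact a3 B h C h' x hxB hxC
        · exact (hdis x ((a1 B h).2 hxB) ((b1 C h').2 hxC)).elim
        · exact (hdis x ((a1 C h').2 hxC) ((b1 B h).2 hxB)).elim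
        · exact b3 B h C h' x hxB hxC
      · intro B hB C hC i hi k hk j hj l hl hij hjk hkl
        rcases Finset.mem_union.1 hB with h | h <;> rcases Finset.mem_union.1 hC with h' | h'
        · exact a4 B h C h' i hi k hk j hj l hl hij hjk hkl
        · exact (hconv i ((a1 B h).2 hi) k ((a1 B h).2 hk) j ((b1 C h').2 hj) hij hjk).elim
        · exact (hconv j ((a1 C h').2 hj) l ((a1 C h').2 hl) k ((b1 B h).2 hk) hjk hkl).elim
        · exact b4 B h C h' i hi k hk j hj l hl hij hjk hkl
      · intro x hx y hy B hB hxB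
        rcases Finset.mem_union.1 hB with h | h
        · exact (hdis x ((a1 B h).2 hxB) (hT hx)).elim
        · exact b5 x hx y hy B h hxB
    refine Finset.mem_filter.2 ⟨hN.mem_pow, hN, ?_⟩
    intro B hB
    rcases Finset.mem_union.1 hB with h | h
    · exact Or.inl (a1 B h).2
    · exact Or.inr (b1 B h).2
  · intro c hc
    obtain ⟨-, ⟨c1, c2, c3, c4, c5⟩, hc⟩ := Finset.mem_filter.1 hc
    have h1 : NCP I ∅ (c.filter (fun B => B ⊆ I)) := by
      refine ⟨?_, ?_, ?_, ?_, ?_⟩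
      · intro B hB
        rw [Finset.mem_filter] at hB
        exact ⟨(c1 B hB.1).1, hB.2⟩
      · intro x hx
        obtain ⟨B, hB, hxB⟩ := c2 x (hs ▸ Finset.mem_union_left _ hx)
        refine ⟨B, Finset.mem_filter.2 ⟨hB, ?_⟩, hxB⟩
        exact (hc B hB).resolve_right (fun h => hdis x hx (h hxB))
      · intro B hB C hC
        exact c3 B (Finset.mem_filter.1 hB).1 C (Finset.mem_filter.1 hC).1
      · intro B hB C hC
        exact c4 B (Finset.mem_filter.1 hB).1 C (Finset.mem_filter.1 hC).1
      · simp
    have h2 : NCP J T (c.filter (fun B => B ⊆ J)) := by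
      refine ⟨?_, ?_, ?_, ?_, ?_⟩
      · intro B hB
        rw [Finset.mem_filter] at hB
        exact ⟨(c1 B hB.1).1, hB.2⟩
      · intro x hx
        obtain ⟨B, hB, hxB⟩ := c2 x (hs ▸ Finset.mem_union_right _ hx)
        refine ⟨B, Finset.mem_filter.2 ⟨hB, ?_⟩, hxB⟩
        exact (hc B hB).resolve_left (fun h => hdis x (h hxB) hx)
      · intro B hB C hC
        exact c3 B (Finset.mem_filter.1 hB).1 C (Finset.mem_filter.1 hC).1
      · intro B hB C hC
        exact c4 B (Finset.mem_filter.1 hB).1 C (Finset.mem_filter.1 hC).1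
      · intro x hx y hy B hB
        exact c5 x hx y hy B (Finset.mem_filter.1 hB).1
    exact Finset.mem_product.2 ⟨Finset.mem_filter.2 ⟨h1.mem_pow, h1⟩,
      Finset.mem_filter.2 ⟨h2.mem_pow, h2⟩⟩
  · rintro ⟨a, b⟩ hab
    simp only [Finset.mem_product, Finset.mem_filter] at hab
    obtain ⟨⟨-, ha⟩, ⟨-, hb⟩⟩ := hab
    have ha' : ∀ B ∈ a, B ⊆ J → False := by
      intro B hB hBJ
      obtain ⟨x, hx⟩ := (ha.1 B hB).1
      exact hdis x ((ha.1 B hB).2 hx) (hBJ hx)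
    have hb' : ∀ B ∈ b, B ⊆ I → False := by
      intro B hB hBJ
      obtain ⟨x, hx⟩ := (hb.1 B hB).1
      exact hdis x (hBJ hx) ((hb.1 B hB).2 hx)
    ext B
    · simp only [Finset.mem_filter, Finset.mem_union]
      constructor
      · rintro ⟨h | h, h'⟩
        · exact h
        · exact (hb' B h h').elim
      · intro h
        exact ⟨Or.inl h, (ha.1 B h).2⟩
    · simp only [Finset.mem_filter, Finset.mem_union]
      constructor
      · rintro ⟨h | h, h'⟩
        · exact (ha' B h h').elim
        · exact h
      · intro h
        exact ⟨Or.inr h, (hb.1 B h).2⟩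
  · intro c hc
    obtain ⟨-, -, hc⟩ := Finset.mem_filter.1 hc
    ext B
    simp only [Finset.mem_filter, Finset.mem_union]
    constructor
    · rintro (h | h) <;> exact h.1
    · intro h
      rcases hc B h with h' | h'
      · exact Or.inl ⟨h, h'⟩
      · exact Or.inr ⟨h, h'⟩
  · rintro ⟨a, b⟩ hab
    simp only [Finset.mem_product, Finset.mem_filter] at hab
    obtain ⟨⟨-, ha⟩, ⟨-, hb⟩⟩ := hab
    rw [Finset.prod_union]
    rw [Finset.disjoint_left]
    intro B hB hBb
    obtain ⟨x, hx⟩ := (ha.1 B hB).1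
    exact hdis x ((ha.1 B hB).2 hx) ((hb.1 B hBb).2 hx)

/-- the fundamental decomposition -/
theorem GG_rec (r : ℕ → ℂ) (k n : ℕ) (hk : 0 < k) :
    GG r (Finset.range (n + k)) (Finset.range k) =
      ∑ p ∈ Finset.Icc k (n + k), GG r (Finset.Ico k p) ∅ *
        GG r (Finset.range k ∪ Finset.Ico p (n + k))
          (Finset.range k ∪ Finset.Ico p (min (p + 1) (n + k))) := by
  classical
  have hsplit : ∀ p ∈ Finset.Icc k (n + k), _ := fun p hp =>
    GG_split r (Finset.range (n + k)) (Finset.Ico k p) (Finset.range k ∪ Finset.Ico p (n + k))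
      (Finset.range k ∪ Finset.Ico p (min (p + 1) (n + k)))
      (by ext x; simp at hp ⊢; omega)
      (by rw [Finset.disjoint_left]; intro x; simp; omega)
      (by intro x; simp; omega)
      (by intro i hi k hk j hj; simp at *; omega)
  rw [← Finset.sum_congr rfl hsplit, ← Finset.sum_biUnion]
  · unfold GG
    refine Finset.sum_congr ?_ (fun _ _ => rfl)
    ext c
    simp only [Finset.mem_filter, Finset.mem_biUnion]
    constructor
    · rintro ⟨hpow, hc⟩
      obtain ⟨c1, c2, c3, c4, c5⟩ := hc
      obtain ⟨B0, hB0, h0⟩ := c2 0 (by simp; omega)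
      have hTB : ∀ x < k, x ∈ B0 := fun x hx => c5 0 (by simpa using hk) x (by simpa using hx) B0 hB0 h0
      have hex : ∃ x, k ≤ x ∧ (x = n + k ∨ x ∈ B0) := ⟨n + k, by omega, Or.inl rfl⟩
      obtain ⟨p, hpp, hmin⟩ : ∃ p, (k ≤ p ∧ (p = n + k ∨ p ∈ B0)) ∧
          ∀ q < p, ¬ (k ≤ q ∧ (q = n + k ∨ q ∈ B0)) :=
        ⟨Nat.find hex, Nat.find_spec hex, fun q hq => Nat.find_min hex hq⟩
      have hple : p ≤ n + k := by
        rcases hpp.2 with h | h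
        · omega
        · have := (c1 B0 hB0).2 h
          simp at this; omega
      refine ⟨p, by simp; omega, hpow, ⟨c1, c2, c3, c4, ?_⟩, ?_⟩
      · have hT : ∀ x ∈ Finset.range k ∪ Finset.Ico p (min (p + 1) (n + k)), x ∈ B0 := by
          intro x hx
          simp at hx
          rcases hx with hx | hx
          · exact hTB x hx
          · have : x = p := by omega
            subst this
            exact hpp.2.resolve_left (by omega)
        intro x hx y hy B hB hxB
        rw [c3 B hB B0 hB0 x hxB (hT x hx)]
        exact hT y hy
      · intro B hB
        by_contra hcon
        push Not at hcon
        obtain ⟨hcI, hcJ⟩ := hcon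
        obtain ⟨y, hyB, hyI⟩ := Finset.not_subset.1 hcI
        obtain ⟨x, hxB, hxJ⟩ := Finset.not_subset.1 hcJ
        have hxs := (c1 B hB).2 hxB
        have hys := (c1 B hB).2 hyB
        simp at hyI hxJ hxs hys
        have hne : B ≠ B0 := by
          rintro rfl
          exact hmin x (by omega) ⟨by omega, Or.inr hxB⟩
        by_cases hyk : y < k
        · exact hne (c3 B hB B0 hB0 y hyB (hTB y hyk))
        · have hpB : p ∈ B0 := hpp.2.resolve_left (by have := hyI (by omega); omega)
          have hpy := hyI (by omega)
          rcases hpy.lt_or_eq with h | h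
          · exact hne (c4 B0 hB0 B hB 0 h0 p hpB x hxB y hyB (by omega) (by omega) h).symm
          · subst h
            exact hne (c3 B hB B0 hB0 p hyB hpB)
    · rintro ⟨p, hp, hpow, ⟨c1, c2, c3, c4, c5⟩, -⟩
      refine ⟨hpow, c1, c2, c3, c4, ?_⟩
      intro x hx y hy
      exact c5 x (Finset.mem_union_left _ hx) y (Finset.mem_union_left _ hy)
  · have key : ∀ p ∈ Finset.Icc k (n + k), ∀ q ∈ Finset.Icc k (n + k), p < q →
        ∀ c, NCP (Finset.range (n + k)) (Finset.range k ∪ Finset.Ico p (min (p + 1) (n + k))) c →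
          (∀ B ∈ c, B ⊆ Finset.Ico k q ∨ B ⊆ Finset.range k ∪ Finset.Ico q (n + k)) → False := by
      intro p hp q hq hpq c hc hB
      simp at hp hq
      obtain ⟨c1, c2, c3, c4, c5⟩ := hc
      obtain ⟨B0, hB0, h0⟩ := c2 0 (by simp; omega)
      have hpB := c5 0 (by simp; omega) p (by simp; omega) B0 hB0 h0
      rcases hB B0 hB0 with h | h
      · have := h h0
        simp at this; omega
      · have := h hpB
        simp at this; omega
    intro p hp q hq hpq
    rw [Function.onFun, Finset.disjoint_left]
    intro c hc hc'
    obtain ⟨-, h1, h2⟩ := Finset.mem_filter.1 hc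
    obtain ⟨-, hq1, hq2⟩ := Finset.mem_filter.1 hc'
    rcases lt_or_gt_of_ne hpq with h | h
    · exact key p hp q hq h c h1 hq2
    · exact key q hq p hp h c hq1 h2

/-- transport from partitions of `Fin m` -/
theorem GG_transport {A : Type*} [Ring A] (R : (k : ℕ) → (Fin k → A) → ℂ) (Z : A)
    (f : ℕ → ℕ) (hf : StrictMono f) (m : ℕ) (T : Finset ℕ)
    (Q : Finpartition (Finset.univ : Finset (Fin m)) → Prop)
    (hQ : ∀ ν, Q ν ↔ (IsNonCrossing ν ∧ ∀ x ∈ T, ∀ y ∈ T, ∀ B ∈ ν.parts,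
      x ∈ B.image (fun i : Fin m => f i) → y ∈ B.image (fun i : Fin m => f i))) :
    ∑ᶠ ν : {ν : Finpartition (Finset.univ : Finset (Fin m)) // Q ν},
        partCum R (fun _ => Z) ν.1 =
      GG (fun k => R k fun _ => Z) ((Finset.range m).image f) T := by
  classical
  set g : Fin m → ℕ := fun i => f i with hg
  have hgm : StrictMono g := fun i j h => hf h
  have hgi : Function.Injective g := hgm.injective
  have hG : Function.Injective (fun B : Finset (Fin m) => B.image g) :=
    Finset.image_injective hgi
  rw [finsum_eq_sum_of_fintype]
  unfold GG
  refine Finset.sum_bij (fun ν _ => ν.1.parts.image (fun B => B.image g)) ?_ ?_ ?_ ?_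
  · rintro ⟨ν, hν⟩ -
    obtain ⟨hnc, hT⟩ := (hQ ν).1 hν
    have hN : NCP ((Finset.range m).image f) T (ν.parts.image (fun B => B.image g)) := by
      refine ⟨?_, ?_, ?_, ?_, ?_⟩
      · intro B' hB'
        obtain ⟨B, hB, rfl⟩ := Finset.mem_image.1 hB'
        refine ⟨(ν.nonempty_of_mem_parts hB).image g, ?_⟩
        intro x hx
        obtain ⟨i, hi, rfl⟩ := Finset.mem_image.1 hx
        exact Finset.mem_image.2 ⟨i, by simp, rfl⟩
      · intro x hx
        obtain ⟨i, hi, rfl⟩ := Finset.mem_image.1 hx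
        rw [Finset.mem_range] at hi
        obtain ⟨B, hB, hiB⟩ := ν.exists_mem (Finset.mem_univ (⟨i, hi⟩ : Fin m))
        exact ⟨B.image g, Finset.mem_image_of_mem _ hB, Finset.mem_image.2 ⟨_, hiB, rfl⟩⟩
      · intro B' hB' C' hC' x hxB hxC
        obtain ⟨B, hB, rfl⟩ := Finset.mem_image.1 hB'
        obtain ⟨C, hC, rfl⟩ := Finset.mem_image.1 hC'
        obtain ⟨i, hi, rfl⟩ := Finset.mem_image.1 hxB
        obtain ⟨j, hj, hij⟩ := Finset.mem_image.1 hxC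
        have := hgi hij
        subst this
        rw [ν.eq_of_mem_parts hB hC hi hj]
      · intro B' hB' C' hC' i' hi' k' hk' j' hj' l' hl' hij hjk hkl
        obtain ⟨B, hB, rfl⟩ := Finset.mem_image.1 hB'
        obtain ⟨C, hC, rfl⟩ := Finset.mem_image.1 hC'
        obtain ⟨i, hi, rfl⟩ := Finset.mem_image.1 hi'
        obtain ⟨k, hk, rfl⟩ := Finset.mem_image.1 hk'
        obtain ⟨j, hj, rfl⟩ := Finset.mem_image.1 hj'
        obtain ⟨l, hl, rfl⟩ := Finset.mem_image.1 hl'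
        by_contra hne
        exact hnc B hB C hC (fun h => hne (by rw [h])) i hi k hk j hj l hl
          (hgm.lt_iff_lt.1 hij) (hgm.lt_iff_lt.1 hjk) (hgm.lt_iff_lt.1 hkl)
      · intro x hx y hy B' hB' hxB
        obtain ⟨B, hB, rfl⟩ := Finset.mem_image.1 hB'
        exact hT x hx y hy B hB hxB
    exact Finset.mem_filter.2 ⟨hN.mem_pow, hN⟩
  · rintro ⟨ν, hν⟩ - ⟨ν', hν'⟩ - h
    apply Subtype.ext
    apply Finpartition.ext
    exact Finset.image_injective hG h
  · intro c hc
    obtain ⟨-, c1, c2, c3, c4, c5⟩ := Finset.mem_filter.1 hc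
    have him : ∀ B ∈ c, (Finset.univ.filter (fun i => g i ∈ B)).image g = B := by
      intro B hB
      ext x
      simp only [Finset.mem_image, Finset.mem_filter, Finset.mem_univ, true_and]
      constructor
      · rintro ⟨i, hi, rfl⟩
        exact hi
      · intro hx
        obtain ⟨i, hi, rfl⟩ := Finset.mem_image.1 ((c1 B hB).2 hx)
        rw [Finset.mem_range] at hi
        exact ⟨⟨i, hi⟩, hx, rfl⟩
    let ν : Finpartition (Finset.univ : Finset (Fin m)) :=
      Finpartition.ofExistsUnique (c.image (fun B => Finset.univ.filter (fun i => g i ∈ B)))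
        (fun p _ => Finset.subset_univ p)
        (by
          intro i _
          obtain ⟨B, hB, hi⟩ := c2 (g i) (Finset.mem_image.2 ⟨i, by simp, rfl⟩)
          refine ⟨Finset.univ.filter (fun i => g i ∈ B),
            ⟨Finset.mem_image_of_mem _ hB, by simpa using hi⟩, ?_⟩
          rintro D ⟨hD, hiD⟩
          obtain ⟨C, hC, rfl⟩ := Finset.mem_image.1 hD
          rw [c3 B hB C hC (g i) hi (by simpa using hiD)])
        (by
          intro h
          obtain ⟨B, hB, hBe⟩ := Finset.mem_image.1 h
          have := him B hB
          rw [hBe] at this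
          have h1 := (c1 B hB).1
          rw [← this] at h1
          simp at h1)
    have hνp : ν.parts = c.image (fun B => Finset.univ.filter (fun i => g i ∈ B)) := rfl
    refine ⟨⟨ν, (hQ ν).2 ⟨?_, ?_⟩⟩, Finset.mem_univ _, ?_⟩
    · intro B' hB' C' hC' hne i hi k hk j hj l hl hij hjk hkl
      rw [hνp] at hB' hC'
      obtain ⟨B, hB, rfl⟩ := Finset.mem_image.1 hB'
      obtain ⟨C, hC, rfl⟩ := Finset.mem_image.1 hC'
      simp only [Finset.mem_filter, Finset.mem_univ, true_and] at hi hk hj hl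
      exact hne (by rw [c4 B hB C hC _ hi _ hk _ hj _ hl (hgm hij) (hgm hjk) (hgm hkl)])
    · intro x hx y hy B' hB' hxB
      rw [hνp] at hB'
      obtain ⟨B, hB, rfl⟩ := Finset.mem_image.1 hB'
      have := him B hB
      rw [hg] at this
      rw [this] at hxB ⊢
      exact c5 x hx y hy B hB hxB
    · show ν.parts.image _ = c
      rw [hνp, Finset.image_image]
      ext D
      simp only [Finset.mem_image, Function.comp]
      constructor
      · rintro ⟨B, hB, rfl⟩
        rw [him B hB]; exact hB
      · intro hD
        exact ⟨D, hD, him D hD⟩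
  · rintro ⟨ν, hν⟩ -
    show _ = ∏ B ∈ ν.parts.image (fun B => B.image g), _
    rw [Finset.prod_image (fun a _ b _ h => hG h)]
    unfold partCum
    refine Finset.prod_congr rfl (fun B _ => ?_)
    rw [Finset.card_image_of_injective _ hgi]

theorem ncSum_eq_GG {A : Type*} [Ring A] (R : (k : ℕ) → (Fin k → A) → ℂ) (Z : A)
    (f : ℕ → ℕ) (hf : StrictMono f) (k m : ℕ) (hk : 0 < k) (hkm : k ≤ m) :
    ncSum R Z k m =
      GG (fun k => R k fun _ => Z) ((Finset.range m).image f) ((Finset.range k).image f) := by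
  unfold ncSum
  apply GG_transport R Z f hf
  intro ν
  refine and_congr_right (fun _ => ?_)
  have hmem : ∀ (B : Finset (Fin m)) (x : ℕ) (hx : x < m),
      f x ∈ B.image (fun i : Fin m => f i) ↔ (⟨x, hx⟩ : Fin m) ∈ B := by
    intro B x hx
    rw [Finset.mem_image]
    constructor
    · rintro ⟨i, hi, h⟩
      have : (i : ℕ) = x := hf.injective h
      subst this
      exact hi
    · intro h
      exact ⟨_, h, rfl⟩
  constructor
  · rintro ⟨B0, hB0, h0⟩ x' hx' y' hy' B hB hxB
    obtain ⟨x, hx, rfl⟩ := Finset.mem_image.1 hx'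
    obtain ⟨y, hy, rfl⟩ := Finset.mem_image.1 hy'
    rw [Finset.mem_range] at hx hy
    rw [hmem _ _ (by omega)] at hxB ⊢
    rw [ν.eq_of_mem_parts hB hB0 hxB (h0 _ hx)]
    exact h0 _ hy
  · intro h
    obtain ⟨B, hB, h0⟩ := ν.exists_mem (Finset.mem_univ (⟨0, by omega⟩ : Fin m))
    refine ⟨B, hB, fun i hi => ?_⟩
    have := h (f 0) (Finset.mem_image_of_mem _ (by simpa using hk)) (f i)
      (Finset.mem_image_of_mem _ (by simpa using hi)) B hB ((hmem B 0 (by omega)).2 h0)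
    exact (hmem B i i.2).1 this

theorem moment_eq_GG {A : Type*} [Ring A] [Algebra ℂ A] (τ : A →ₗ[ℂ] ℂ) (h1 : τ 1 = 1)
    (R : (k : ℕ) → (Fin k → A) → ℂ) (hR : MomentCumulant τ R) (Z : A)
    (f : ℕ → ℕ) (hf : StrictMono f) (m : ℕ) :
    τ (Z ^ m) = GG (fun k => R k fun _ => Z) ((Finset.range m).image f) ∅ := by
  rcases Nat.eq_zero_or_pos m with rfl | hm
  · simp [h1, GG_empty]
  · have := hR m hm (fun _ => Z)
    rw [List.ofFn_const, List.prod_replicate] at this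
    rw [this]
    apply GG_transport R Z f hf
    simp

theorem ncSum_one {A : Type*} [Ring A] [Algebra ℂ A] (τ : A →ₗ[ℂ] ℂ) (h1 : τ 1 = 1)
    (R : (k : ℕ) → (Fin k → A) → ℂ) (hR : MomentCumulant τ R) (Z : A) (n : ℕ) :
    ncSum R Z 1 (n + 1) = τ (Z ^ (n + 1)) := by
  rw [ncSum_eq_GG R Z id strictMono_id 1 (n + 1) (by omega) (by omega),
    moment_eq_GG τ h1 R hR Z id strictMono_id]
  simp [GG_singleton]

theorem ncSum_rec {A : Type*} [Ring A] [Algebra ℂ A] (τ : A →ₗ[ℂ] ℂ) (h1 : τ 1 = 1)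
    (R : (k : ℕ) → (Fin k → A) → ℂ) (hR : MomentCumulant τ R) (Z : A) (k n : ℕ) (hk : 0 < k) :
    ncSum R Z k (n + k) = (∑ j ∈ Finset.range n, τ (Z ^ j) * ncSum R Z (k + 1) (n - 1 - j + (k + 1)))
      + (R k fun _ => Z) * τ (Z ^ n) := by
  rw [ncSum_eq_GG R Z id strictMono_id k (n + k) hk (by omega), Finset.image_id, Finset.image_id,
    GG_rec _ k n hk]
  have hI : Finset.Icc k (n + k) = (Finset.range (n + 1)).image (fun j => j + k) := by
    ext x
    simp only [Finset.mem_Icc, Finset.mem_image, Finset.mem_range]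
    constructor
    · intro h
      exact ⟨x - k, by omega, by omega⟩
    · rintro ⟨j, hj, rfl⟩
      omega
  have hIco : ∀ j, Finset.Ico k (j + k) = (Finset.range j).image (fun j => j + k) := by
    intro j
    ext x
    simp only [Finset.mem_Ico, Finset.mem_image, Finset.mem_range]
    constructor
    · intro h
      exact ⟨x - k, by omega, by omega⟩
    · rintro ⟨j, hj, rfl⟩
      omega
  rw [hI, Finset.sum_image (fun a _ b _ h => by simpa using h), Finset.sum_range_succ]
  have hmono : StrictMono (fun j => j + k) := fun a b h => by simpa using h
  congr 1
  · refine Finset.sum_congr rfl (fun j hj => ?_)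
    rw [Finset.mem_range] at hj
    rw [hIco, ← moment_eq_GG τ h1 R hR Z _ hmono]
    congr 1
    have hm : StrictMono (fun x => if x < k then x else x + j) := by
      intro a b h
      dsimp only
      split_ifs <;> omega
    rw [ncSum_eq_GG R Z _ hm (k + 1) _ (by omega) (by omega)]
    congr 1
    · ext x
      simp only [Finset.mem_union, Finset.mem_range, Finset.mem_Ico, Finset.mem_image]
      constructor
      · rintro (h | h)
        · exact ⟨x, by omega, by simp [h]⟩
        · exact ⟨x - j, by omega, by rw [if_neg (by omega)]; omega⟩
      · rintro ⟨y, hy, rfl⟩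
        split_ifs <;> omega
    · ext x
      simp only [Finset.mem_union, Finset.mem_range, Finset.mem_Ico, Finset.mem_image]
      constructor
      · rintro (h | h)
        · exact ⟨x, by omega, by simp [h]⟩
        · exact ⟨x - j, by omega, by rw [if_neg (by omega)]; omega⟩
      · rintro ⟨y, hy, rfl⟩
        split_ifs <;> omega
  · rw [hIco, ← moment_eq_GG τ h1 R hR Z _ hmono, mul_comm]
    have hself := GG_self (fun k => R k fun _ => Z) (Finset.range k) ⟨0, by simpa using hk⟩
    beta_reduce at hself
    rw [Finset.card_range] at hself
    simp [hself]

/-- deconvolution bound -/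
theorem deconv_bound (a b : ℕ → ℂ) (C D : ℝ) (hC : 0 ≤ C) (_hD : 0 ≤ D) (ha0 : a 0 = 1)
    (ha : ∀ n, ‖a n‖ ≤ C ^ n)
    (hab : ∀ n, ‖∑ j ∈ Finset.range (n + 1), a j * b (n - j)‖ ≤ D * C ^ n) :
    ∀ n, ‖b n‖ ≤ D * (2 * C) ^ n := by
  intro n
  induction n using Nat.strong_induction_on with
  | _ n ih =>
    have h := hab n
    rw [Finset.sum_range_succ', ha0] at h
    simp only [one_mul, Nat.sub_zero] at h
    have h2 : ‖∑ j ∈ Finset.range n, a (j + 1) * b (n - (j + 1))‖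
        ≤ D * C ^ n * (2 ^ n - 1) := by
      calc _ ≤ ∑ j ∈ Finset.range n, D * C ^ n * 2 ^ (n - 1 - j) := by
            refine norm_sum_le_of_le _ (fun j hj => ?_)
            rw [Finset.mem_range] at hj
            rw [norm_mul]
            calc _ ≤ C ^ (j + 1) * (D * (2 * C) ^ (n - (j + 1))) := by
                  gcongr
                  · exact ha _
                  · exact ih _ (by omega)
              _ = D * C ^ n * 2 ^ (n - 1 - j) := by
                  have : n = (j + 1) + (n - 1 - j) := by omega
                  rw [show n - (j + 1) = n - 1 - j by omega]
                  conv_rhs => rw [this]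
                  rw [show (j + 1) + (n - 1 - j) - 1 - j = n - 1 - j by omega]
                  rw [pow_add C, mul_pow]
                  ring
        _ = _ := by
            rw [← Finset.mul_sum, Finset.sum_range_reflect (fun i => (2 : ℝ) ^ i) n,
              geom_sum_eq (by norm_num)]
            norm_num
    have h3 := norm_sub_le (∑ j ∈ Finset.range n, a (j + 1) * b (n - (j + 1)) + b n)
      (∑ j ∈ Finset.range n, a (j + 1) * b (n - (j + 1)))
    rw [add_sub_cancel_left] at h3
    calc _ ≤ D * C ^ n + D * C ^ n * (2 ^ n - 1) := by linarith
      _ = _ := by rw [mul_pow]; ring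

theorem summable_of_geom (b : ℕ → ℂ) (K D : ℝ) (hK : 0 < K) (hb : ∀ n, ‖b n‖ ≤ D * K ^ n)
    (z : ℂ) (hz : ‖z‖ < K⁻¹) : Summable (fun n => ‖b n * z ^ n‖) := by
  have h1 : K * ‖z‖ < 1 := by
    calc _ < K * K⁻¹ := by gcongr
      _ = 1 := mul_inv_cancel₀ hK.ne'
  refine Summable.of_nonneg_of_le (fun _ => norm_nonneg _) (fun n => ?_)
    ((summable_geometric_of_lt_one (by positivity) h1).mul_left D)
  rw [norm_mul, norm_pow, mul_pow, ← mul_assoc]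
  gcongr
  exact hb n

/-- One step: from a coefficient recursion to a generating function identity. -/
theorem gen_step (a b c : ℕ → ℂ) (ρ z : ℂ) (k : ℕ)
    (hrec : ∀ n, c (n + 1) = (∑ j ∈ Finset.range (n + 1), a j * b (n - j)) + ρ * a (n + 1))
    (hc0 : c 0 = ρ * a 0)
    (ha : Summable (fun n => ‖a n * z ^ n‖)) (hb : Summable (fun n => ‖b n * z ^ n‖))
    (hc : Summable (fun n => ‖c n * z ^ n‖)) :
    (∑' n, c n * z ^ (k + n)) = (∑' n, a n * z ^ n) * (∑' n, b n * z ^ (k + 1 + n))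
      + ρ * z ^ k * ∑' n, a n * z ^ n := by
  have e1 : (∑' n, c n * z ^ (k + n)) = z ^ k * ∑' n, c n * z ^ n := by
    rw [← tsum_mul_left]; congr 1; ext n; ring
  have e2 : (∑' n, b n * z ^ (k + 1 + n)) = z ^ k * (z * ∑' n, b n * z ^ n) := by
    rw [← tsum_mul_left, ← tsum_mul_left]; congr 1; ext n; ring
  have e3 : (∑' n, c n * z ^ n) = z * ((∑' n, a n * z ^ n) * ∑' n, b n * z ^ n)
      + ρ * ∑' n, a n * z ^ n := by
    have hprod := tsum_mul_tsum_eq_tsum_sum_range_of_summable_norm ha hb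
    have hps := (summable_norm_sum_mul_range_of_summable_norm ha hb).of_norm
    rw [hprod, hc.of_norm.tsum_eq_zero_add, ha.of_norm.tsum_eq_zero_add, ← tsum_mul_left, hc0]
    have ha' : Summable (fun n => a (n + 1) * z ^ (n + 1)) :=
      (summable_nat_add_iff 1).2 ha.of_norm
    rw [mul_add, ← tsum_mul_left, add_left_comm, ← (hps.mul_left z).tsum_add (ha'.mul_left ρ)]
    congr 1
    · ring
    congr 1
    ext n
    rw [hrec, add_mul, Finset.sum_mul, Finset.mul_sum]
    congr 1
    · refine Finset.sum_congr rfl (fun j hj => ?_)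
      rw [Finset.mem_range] at hj
      have : z ^ (n + 1) = z * (z ^ j * z ^ (n - j)) := by
        rw [← pow_add, ← pow_succ']; congr 1; omega
      rw [this]; ring
    · ring
  rw [e1, e2, e3]; ring

/-- Example 2.5. For a self-adjoint `Z` with compactly
supported distribution, writing `M(z) = Σ_n τ(Zⁿ) zⁿ` and
`C^{(k)}(z) = Σ_n c^k_n z^{k+n}` with `c^k_n = Σ_{ν ∈ NC^k(n+k)} R_ν(Z)`, for
`|z|` small enough:
`M(z) − 1 = M(z) C^{(2)}(z) + R₁(Z) z M(z)`, equivalently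
`1/M(z) = 1 − C^{(2)}(z) − R₁(Z) z`, and
`C^{(2)}(z) = M(z) C^{(3)}(z) + R₂(Z) z² M(z)`. -/
theorem stmt4 {A : Type*} [Ring A] [Algebra ℂ A] [StarRing A] [TopologicalSpace A]
    (ts : TracialState A) (R : (k : ℕ) → (Fin k → A) → ℂ)
    (hR : MomentCumulant ts.τ R)
    (Z : A) (hZ : star Z = Z)
    (hbound : ∃ C : ℝ, ∀ n : ℕ, ‖ts.τ (Z ^ n)‖ ≤ C ^ n) :
    ∃ ε : ℝ, 0 < ε ∧ ∀ z : ℂ, ‖z‖ < ε →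
      ((∑' n : ℕ, ts.τ (Z ^ n) * z ^ n) - 1 =
          (∑' n : ℕ, ts.τ (Z ^ n) * z ^ n) *
              (∑' n : ℕ, ncSum R Z 2 (n + 2) * z ^ (2 + n))
            + (R 1 fun _ => Z) * z * (∑' n : ℕ, ts.τ (Z ^ n) * z ^ n)) ∧
      (∑' n : ℕ, ts.τ (Z ^ n) * z ^ n) ≠ 0 ∧
      ((∑' n : ℕ, ts.τ (Z ^ n) * z ^ n)⁻¹ =
          1 - (∑' n : ℕ, ncSum R Z 2 (n + 2) * z ^ (2 + n)) - (R 1 fun _ => Z) * z) ∧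
      ((∑' n : ℕ, ncSum R Z 2 (n + 2) * z ^ (2 + n)) =
          (∑' n : ℕ, ts.τ (Z ^ n) * z ^ n) *
              (∑' n : ℕ, ncSum R Z 3 (n + 3) * z ^ (3 + n))
            + (R 2 fun _ => Z) * z ^ 2 * (∑' n : ℕ, ts.τ (Z ^ n) * z ^ n)) := by
  obtain ⟨C0, hC0⟩ := hbound
  set a : ℕ → ℂ := fun n => ts.τ (Z ^ n) with ha_def
  set c1 : ℕ → ℂ := fun n => ncSum R Z 1 (n + 1) with hc1_def
  set c2 : ℕ → ℂ := fun n => ncSum R Z 2 (n + 2) with hc2_def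
  set c3 : ℕ → ℂ := fun n => ncSum R Z 3 (n + 3) with hc3_def
  set r1 : ℂ := R 1 fun _ => Z with hr1
  set r2 : ℂ := R 2 fun _ => Z with hr2
  have ha0 : a 0 = 1 := by simp [ha_def, ts.map_one]
  have hc1a : ∀ n, c1 n = a (n + 1) := fun n => ncSum_one ts.τ ts.map_one R hR Z n
  have rec1 : ∀ n, c1 (n + 1) =
      (∑ j ∈ Finset.range (n + 1), a j * c2 (n - j)) + r1 * a (n + 1) := fun n =>
    ncSum_rec ts.τ ts.map_one R hR Z 1 (n + 1) (by norm_num)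
  have rec10 : c1 0 = r1 * a 0 := by
    have h := ncSum_rec ts.τ ts.map_one R hR Z 1 0 (by norm_num)
    rw [Finset.sum_range_zero, zero_add, zero_add] at h
    exact h
  have rec2 : ∀ n, c2 (n + 1) =
      (∑ j ∈ Finset.range (n + 1), a j * c3 (n - j)) + r2 * a (n + 1) := fun n =>
    ncSum_rec ts.τ ts.map_one R hR Z 2 (n + 1) (by norm_num)
  have rec20 : c2 0 = r2 * a 0 := by
    have h := ncSum_rec ts.τ ts.map_one R hR Z 2 0 (by norm_num)
    rw [Finset.sum_range_zero, zero_add, zero_add] at h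
    exact h
  -- bounds
  set C : ℝ := |C0| + 1 with hC
  have hCpos : 0 < C := by positivity
  have haC : ∀ n, ‖a n‖ ≤ C ^ n := fun n => by
    refine (hC0 n).trans ?_
    calc C0 ^ n ≤ |C0 ^ n| := le_abs_self _
      _ = |C0| ^ n := abs_pow _ _
      _ ≤ C ^ n := by gcongr; linarith
  have hb2 : ∀ n, ‖c2 n‖ ≤ (C ^ 2 + ‖r1‖ * C) * (2 * C) ^ n := by
    refine deconv_bound a c2 C _ hCpos.le (by positivity) ha0 haC (fun n => ?_)
    rw [eq_sub_iff_add_eq.2 (rec1 n).symm, hc1a]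
    refine (norm_sub_le _ _).trans ?_
    rw [norm_mul]
    calc _ ≤ C ^ (n + 1 + 1) + ‖r1‖ * C ^ (n + 1) := by
          gcongr
          · exact haC _
          · exact haC _
      _ = _ := by ring
  have haC2 : ∀ n, ‖a n‖ ≤ (2 * C) ^ n := fun n => by
    refine (haC n).trans ?_
    gcongr; linarith
  have hb3 : ∀ n, ‖c3 n‖ ≤ ((C ^ 2 + ‖r1‖ * C) * (2 * C) + ‖r2‖ * (2 * C)) * (2 * (2 * C)) ^ n := by
    refine deconv_bound a c3 (2 * C) _ (by positivity) (by positivity) ha0 haC2 (fun n => ?_)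
    rw [eq_sub_iff_add_eq.2 (rec2 n).symm]
    refine (norm_sub_le _ _).trans ?_
    rw [norm_mul]
    calc _ ≤ (C ^ 2 + ‖r1‖ * C) * (2 * C) ^ (n + 1) + ‖r2‖ * (2 * C) ^ (n + 1) := by
          gcongr
          · exact hb2 _
          · exact haC2 _
      _ = _ := by ring
  refine ⟨(2 * (2 * C))⁻¹, by positivity, fun z hz => ?_⟩
  have hz1 : ‖z‖ < C⁻¹ := hz.trans_le (by gcongr; linarith)
  have hz2 : ‖z‖ < (2 * C)⁻¹ := hz.trans_le (by gcongr; linarith)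
  have sa := summable_of_geom a C 1 hCpos (by simpa using haC) z hz1
  have s2 := summable_of_geom c2 _ _ (by positivity) hb2 z hz2
  have s3 := summable_of_geom c3 _ _ (by positivity) hb3 z hz
  have s1 := summable_of_geom c1 C C hCpos
    (fun n => by rw [hc1a, ← pow_succ']; exact haC _) z hz1
  have g1 := gen_step a c2 c1 r1 z 1 rec1 rec10 sa s2 s1
  have g2 := gen_step a c3 c2 r2 z 2 rec2 rec20 sa s3 s2
  have eM : (∑' n, a n * z ^ n) - 1 = ∑' n, c1 n * z ^ (1 + n) := by
    rw [sa.of_norm.tsum_eq_zero_add, ha0]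
    simp only [pow_zero, mul_one, add_sub_cancel_left]
    congr 1
    ext n
    rw [hc1a, add_comm 1 n]
  rw [← eM, pow_one] at g1
  norm_num at g1 g2
  have hprod : (∑' n, a n * z ^ n) * (1 - (∑' n, c2 n * z ^ (2 + n)) - r1 * z) = 1 := by
    linear_combination g1
  exact ⟨g1, left_ne_zero_of_mul_eq_one hprod, inv_eq_of_mul_eq_one_right hprod, g2⟩
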